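/- Let p, p', q, q' be integers with Δ := p·q' − p'·q > 0, and let S denote the three-element set {(p,p'), (q,q'), (−p−q, −p'−q')} of pairs of integers. Then the following are equivalent: (i) there exists (m,m') ∈ S such that Δ divides both m and m'; (ii) there exist two distinct pairs (a,a'), (b,b') ∈ S and integers c, c' such that a·c' − a'·c = 1 and b·c' − b'·c = −1. -/

import Mathlib

/-- By Cramer's rule, the system `a * c' - a' * c = 1`, `b * c' - b' * c = -1` is solvable over
the integers exactly when the determinant `a * b' - a' * b` divides both coordinates of
`(a, a') + (b, b')`. -/
lemma det_dvd_add_iff_exists_solution {a a' b b' : ℤ} (hD : a * b' - a' * b ≠ 0) :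
    (a * b' - a' * b ∣ a + b ∧ a * b' - a' * b ∣ a' + b') ↔
      ∃ c c' : ℤ, a * c' - a' * c = 1 ∧ b * c' - b' * c = -1 := by
  constructor
  · rintro ⟨⟨c, hc⟩, ⟨c', hc'⟩⟩
    refine ⟨c, c', mul_left_cancel₀ hD ?_, mul_left_cancel₀ hD ?_⟩
    · linear_combination a' * hc - a * hc'
    · linear_combination b' * hc - b * hc'
  · rintro ⟨c, c', h₁, h₂⟩
    exact ⟨⟨c, by linear_combination a * h₂ - b * h₁⟩,
      ⟨c', by linear_combination a' * h₂ - b' * h₁⟩⟩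

theorem divisibility_iff_unimodular (p p' q q' : ℤ) (hΔ : 0 < p * q' - p' * q) :
    (∃ mm' ∈ ({(p, p'), (q, q'), (-p - q, -p' - q')} : Set (ℤ × ℤ)),
        (p * q' - p' * q) ∣ mm'.1 ∧ (p * q' - p' * q) ∣ mm'.2) ↔
    (∃ ab ∈ ({(p, p'), (q, q'), (-p - q, -p' - q')} : Set (ℤ × ℤ)),
      ∃ bb ∈ ({(p, p'), (q, q'), (-p - q, -p' - q')} : Set (ℤ × ℤ)),
        ab ≠ bb ∧ ∃ c c' : ℤ, ab.1 * c' - ab.2 * c = 1 ∧ bb.1 * c' - bb.2 * c = -1) := by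
  have hqr : q * (-p' - q') - q' * (-p - q) = p * q' - p' * q := by ring
  have hrp : (-p - q) * p' - (-p' - q') * p = p * q' - p' * q := by ring
  have key_pq := det_dvd_add_iff_exists_solution hΔ.ne'
  have key_qr := det_dvd_add_iff_exists_solution (hqr ▸ hΔ.ne')
  have key_rp := det_dvd_add_iff_exists_solution (hrp ▸ hΔ.ne')
  rw [hqr, show q + (-p - q) = -p by ring, show q' + (-p' - q') = -p' by ring,
    dvd_neg, dvd_neg] at key_qr
  rw [hrp, show -p - q + p = -q by ring, show -p' - q' + p' = -q' by ring,
    dvd_neg, dvd_neg] at key_rp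
  -- The system is symmetric in the two pairs up to the sign of `(c, c')`.
  have swap {a a' b b' : ℤ} (h : ∃ c c' : ℤ, a * c' - a' * c = 1 ∧ b * c' - b' * c = -1) :
      ∃ c c' : ℤ, b * c' - b' * c = 1 ∧ a * c' - a' * c = -1 := by
    obtain ⟨c, c', h₁, h₂⟩ := h
    exact ⟨-c, -c', by linear_combination -h₂, by linear_combination -h₁⟩
  have distinct {a b : ℤ × ℤ} (h : ∃ c c' : ℤ, a.1 * c' - a.2 * c = 1 ∧ b.1 * c' - b.2 * c = -1) :
      a ≠ b := by
    rintro rfl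
    obtain ⟨c, c', h₁, h₂⟩ := h
    omega
  constructor
  · rintro ⟨_, rfl | rfl | rfl, hm⟩
    · have h := key_qr.1 hm
      exact ⟨(q, q'), by simp, (-p - q, -p' - q'), by simp, distinct h, h⟩
    · have h := key_rp.1 hm
      exact ⟨(-p - q, -p' - q'), by simp, (p, p'), by simp, distinct h, h⟩
    · have h := key_pq.1 (by
        rw [← dvd_neg, ← dvd_neg (b := p' + q'), neg_add', neg_add']
        exact hm)
      exact ⟨(p, p'), by simp, (q, q'), by simp, distinct h, h⟩
  · have of_pq (h : ∃ c c' : ℤ, p * c' - p' * c = 1 ∧ q * c' - q' * c = -1) :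
        p * q' - p' * q ∣ -p - q ∧ p * q' - p' * q ∣ -p' - q' := by
      rw [← neg_add', ← neg_add', dvd_neg, dvd_neg]
      exact key_pq.2 h
    rintro ⟨_, rfl | rfl | rfl, _, rfl | rfl | rfl, hne, h⟩
    · exact absurd rfl hne
    · exact ⟨(-p - q, -p' - q'), by simp, of_pq h⟩
    · exact ⟨(q, q'), by simp, key_rp.2 (swap h)⟩
    · exact ⟨(-p - q, -p' - q'), by simp, of_pq (swap h)⟩
    · exact absurd rfl hne
    · exact ⟨(p, p'), by simp, key_qr.2 h⟩
    · exact ⟨(q, q'), by simp, key_rp.2 h⟩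
    · exact ⟨(p, p'), by simp, key_qr.2 (swap h)⟩
    · exact absurd rfl hne
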